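/- arXiv:2505.05347 — 5 statements merged into one kernel-verified Lean document; each statement's English description precedes it below -/
import Mathlib

section
/- One-sided tail bound for the discrete Gaussian weights: for every $\sigma > 0$ and every real $t \ge 0$, $\sum_{x \in \mathbb{Z},\ x \ge t} e^{-x^2/(2\sigma^2)} \le e^{-t^2/(2\sigma^2)} \cdot \sum_{x \in \mathbb{Z}} e^{-x^2/(2\sigma^2)}$. Equivalently, a random variable $Z$ distributed as the discrete Gaussian $\mathcal{N}_{\mathbb{Z}}(0,\sigma^2)$, whose probability mass at $x \in \mathbb{Z}$ is proportional to $e^{-x^2/(2\sigma^2)}$, satisfies $\Pr[Z \ge t] \le e^{-t^2/(2\sigma^2)}$ for all $t \ge 0$. -/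
open Real

theorem summable_int_exp_neg_sq_div (σ : ℝ) (hσ : 0 < σ) :
    Summable fun x : ℤ => Real.exp (-(x : ℝ) ^ 2 / (2 * σ ^ 2)) := by
  have hT : 0 < 1 / (2 * π * σ ^ 2) := by positivity
  refine (summable_pow_mul_jacobiTheta₂_term_bound 0 hT 0).congr fun x => ?_
  rw [pow_zero, one_mul]
  congr 1
  field_simp
  ring

/-- **One-sided tail bound for the discrete Gaussian weights.**
For every `σ > 0` and real `t ≥ 0`,
`∑_{x ∈ ℤ, x ≥ t} exp(-x²/(2σ²)) ≤ exp(-t²/(2σ²)) · ∑_{x ∈ ℤ} exp(-x²/(2σ²))`;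
equivalently a discrete Gaussian `Z ∼ 𝒩_ℤ(0,σ²)` satisfies
`Pr[Z ≥ t] ≤ exp(-t²/(2σ²))` for all `t ≥ 0`. -/
theorem discrete_gaussian_one_sided_tail
    (σ : ℝ) (hσ : 0 < σ) (t : ℝ) (ht : 0 ≤ t) :
    (∑' x : {x : ℤ // t ≤ (x : ℝ)}, Real.exp (-((x : ℤ) : ℝ) ^ 2 / (2 * σ ^ 2)))
      ≤ Real.exp (-t ^ 2 / (2 * σ ^ 2))
        * ∑' x : ℤ, Real.exp (-(x : ℝ) ^ 2 / (2 * σ ^ 2)) := by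
  have hsum := summable_int_exp_neg_sq_div σ hσ
  rw [← tsum_mul_left]
  refine (hsum.subtype _).tsum_le_tsum_of_inj (fun x => (x : ℤ) - ⌈t⌉)
    (fun x y h => Subtype.ext (sub_left_injective h)) (fun _ _ => by positivity) ?_
    (hsum.mul_left _)
  rintro ⟨x, hx⟩
  have htm : t ≤ ⌈t⌉ := Int.le_ceil t
  have hmx : (⌈t⌉ : ℝ) ≤ x := by exact_mod_cast Int.ceil_le.mpr hx
  rw [← Real.exp_add, ← add_div]
  gcongr
  push_cast
  nlinarith
end

section
/- Two-sided tail bound for the discrete Gaussian weights: for every $\sigma > 0$ and every real $t \ge 0$, $\sum_{x \in \mathbb{Z},\ |x| \ge t} e^{-x^2/(2\sigma^2)} \le 2\, e^{-t^2/(2\sigma^2)} \cdot \sum_{x \in \mathbb{Z}} e^{-x^2/(2\sigma^2)}$. Equivalently, a random variable $Z$ distributed as the discrete Gaussian $\mathcal{N}_{\mathbb{Z}}(0,\sigma^2)$ satisfies $\Pr[|Z| \ge t] \le 2 e^{-t^2/(2\sigma^2)}$ for all $t \ge 0$. -/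
open Real

theorem summable_exp_neg_int_sq_div {a : ℝ} (ha : 0 < a) :
    Summable fun x : ℤ => Real.exp (-(x : ℝ) ^ 2 / a) := by
  have hτ : 0 < (Complex.I * ((π * a)⁻¹ : ℝ)).im := by
    simp only [Complex.I_mul_im, Complex.ofReal_re]
    positivity
  refine ((summable_jacobiTheta₂_term_iff 0 _).mpr hτ).norm.congr fun x => ?_
  rw [norm_jacobiTheta₂_term, Complex.I_mul_im, Complex.ofReal_re, Complex.zero_im]
  congr 1
  field_simp
  ring

theorem exp_neg_sq_div_le_mul_exp_neg_sub_sq_div {a t m x : ℝ} (ha : 0 < a) (ht : 0 ≤ t)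
    (htm : t ≤ m) (hmx : m ≤ x) :
    Real.exp (-x ^ 2 / a) ≤ Real.exp (-t ^ 2 / a) * Real.exp (-(x - m) ^ 2 / a) := by
  rw [← Real.exp_add, ← add_div]
  gcongr
  nlinarith [mul_nonneg (ht.trans htm) (sub_nonneg.mpr hmx)]

/-- **Two-sided tail bound for the discrete Gaussian weights.**
For every `σ > 0` and real `t ≥ 0`,
`∑_{x ∈ ℤ, |x| ≥ t} exp(-x²/(2σ²)) ≤ 2 exp(-t²/(2σ²)) · ∑_{x ∈ ℤ} exp(-x²/(2σ²))`;
equivalently a discrete Gaussian `Z ∼ 𝒩_ℤ(0,σ²)` satisfies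
`Pr[|Z| ≥ t] ≤ 2 exp(-t²/(2σ²))` for all `t ≥ 0`. -/
theorem discrete_gaussian_two_sided_tail
    (σ : ℝ) (hσ : 0 < σ) (t : ℝ) (ht : 0 ≤ t) :
    (∑' x : {x : ℤ // t ≤ |(x : ℝ)|}, Real.exp (-((x : ℤ) : ℝ) ^ 2 / (2 * σ ^ 2)))
      ≤ 2 * Real.exp (-t ^ 2 / (2 * σ ^ 2))
        * ∑' x : ℤ, Real.exp (-(x : ℝ) ^ 2 / (2 * σ ^ 2)) := by
  have ha : 0 < 2 * σ ^ 2 := by positivity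
  generalize 2 * σ ^ 2 = a at ha
  set f : ℤ → ℝ := fun x => Real.exp (-(x : ℝ) ^ 2 / a) with hf
  have hsum : Summable f := summable_exp_neg_int_sq_div ha
  set m : ℤ := ⌈t⌉
  have htm : t ≤ m := Int.le_ceil t
  have hsub : Summable fun x : ℤ => f (x - m) := (Equiv.subRight m).summable_iff.mpr hsum
  have hadd : Summable fun x : ℤ => f (x + m) := (Equiv.addRight m).summable_iff.mpr hsum
  have hbound : Summable fun x : ℤ => Real.exp (-t ^ 2 / a) * (f (x - m) + f (x + m)) :=
    (hsub.add hadd).mul_left _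
  calc ∑' x : {x : ℤ // t ≤ |(x : ℝ)|}, f x
      ≤ ∑' x : ℤ, Real.exp (-t ^ 2 / a) * (f (x - m) + f (x + m)) := by
        refine Summable.tsum_le_tsum_of_inj Subtype.val Subtype.val_injective
          (fun x _ => by positivity) (fun ⟨x, hx⟩ => ?_) (hsum.subtype _) hbound
        rw [mul_add]
        rcases le_abs.mp hx with hx | hx
        · have hmx : (m : ℝ) ≤ x := mod_cast Int.ceil_le.mpr hx
          have h := exp_neg_sq_div_le_mul_exp_neg_sub_sq_div ha ht htm hmx
          refine le_add_of_le_of_nonneg ?_ (by positivity)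
          simpa [hf] using h
        · have hmx : (m : ℝ) ≤ -x := mod_cast Int.ceil_le.mpr (by exact_mod_cast hx)
          have h := exp_neg_sq_div_le_mul_exp_neg_sub_sq_div ha ht htm hmx
          refine le_add_of_nonneg_of_le (by positivity) ?_
          rw [neg_sq, show (-(x : ℝ) - m) ^ 2 = (x + m) ^ 2 by ring] at h
          simpa [hf] using h
    _ = 2 * Real.exp (-t ^ 2 / a) * ∑' x : ℤ, f x := by
        rw [tsum_mul_left, hsub.tsum_add hadd,
          show ∑' x : ℤ, f (x - m) = ∑' x, f x from (Equiv.subRight m).tsum_eq f,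
          show ∑' x : ℤ, f (x + m) = ∑' x, f x from (Equiv.addRight m).tsum_eq f]
        ring
end

section
/- Variance bound for the discrete Gaussian weights: for every $\sigma > 0$, $\sum_{x \in \mathbb{Z}} x^2\, e^{-x^2/(2\sigma^2)} \le \sigma^2 \cdot \sum_{x \in \mathbb{Z}} e^{-x^2/(2\sigma^2)}$. Equivalently, a random variable $Z$ distributed as the discrete Gaussian $\mathcal{N}_{\mathbb{Z}}(0,\sigma^2)$ satisfies $\mathrm{Var}[Z] \le \mathbb{E}[Z^2] \le \sigma^2$. -/
open Real

theorem summable_int_pow_mul_exp_neg_pi_mul_sq (k : ℕ) {t : ℝ} (ht : 0 < t) :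
    Summable fun n : ℤ => |(n : ℝ)| ^ k * Real.exp (-π * t * (n : ℝ) ^ 2) := by
  refine (HurwitzKernelBounds.summable_f_int k 0 ht).congr fun n => ?_
  simp only [HurwitzKernelBounds.f_int, add_zero]
  congr 2
  ring

theorem summable_exp_neg_pi_mul_int_sq {t : ℝ} (ht : 0 < t) :
    Summable fun n : ℤ => Real.exp (-π * t * (n : ℝ) ^ 2) := by
  simpa using summable_int_pow_mul_exp_neg_pi_mul_sq 0 ht

theorem summable_sq_mul_exp_neg_pi_mul_int_sq {t : ℝ} (ht : 0 < t) :
    Summable fun n : ℤ => (n : ℝ) ^ 2 * Real.exp (-π * t * (n : ℝ) ^ 2) := by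
  simpa using summable_int_pow_mul_exp_neg_pi_mul_sq 2 ht

/-- Poisson summation for the Gaussian, parametrized by the square root of the exponent. -/
theorem mul_tsum_exp_neg_pi_mul_int_sq {r : ℝ} (hr : 0 < r) :
    r * ∑' n : ℤ, Real.exp (-π * r ^ 2 * (n : ℝ) ^ 2) =
      ∑' n : ℤ, Real.exp (-π / r ^ 2 * (n : ℝ) ^ 2) := by
  rw [Real.tsum_exp_neg_mul_int_sq (by positivity), ← Real.sqrt_eq_rpow, Real.sqrt_sq hr.le]
  field_simp

theorem mul_tsum_exp_neg_pi_mul_int_sq_le {r s : ℝ} (hr : 0 < r) (hrs : r ≤ s) :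
    r * ∑' n : ℤ, Real.exp (-π * r ^ 2 * (n : ℝ) ^ 2) ≤
      s * ∑' n : ℤ, Real.exp (-π * s ^ 2 * (n : ℝ) ^ 2) := by
  have hs : 0 < s := hr.trans_le hrs
  rw [mul_tsum_exp_neg_pi_mul_int_sq hr, mul_tsum_exp_neg_pi_mul_int_sq hs]
  have summable_inv {u : ℝ} (hu : 0 < u) :
      Summable fun n : ℤ => Real.exp (-π / u ^ 2 * (n : ℝ) ^ 2) := by
    simpa only [div_eq_mul_inv] using
      summable_exp_neg_pi_mul_int_sq (t := (u ^ 2)⁻¹) (by positivity)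
  refine (summable_inv hr).tsum_le_tsum (fun n => ?_) (summable_inv hs)
  rw [neg_div, neg_div, neg_mul, neg_mul]
  gcongr

theorem tsum_exp_neg_pi_mul_int_sq_add_le {t u : ℝ} (ht : 0 < t) (hu : 0 < u) :
    ∑' n : ℤ, Real.exp (-π * t * (n : ℝ) ^ 2) +
        π * (t - u) * ∑' n : ℤ, (n : ℝ) ^ 2 * Real.exp (-π * t * (n : ℝ) ^ 2) ≤
      ∑' n : ℤ, Real.exp (-π * u * (n : ℝ) ^ 2) := by
  have h₀ := summable_exp_neg_pi_mul_int_sq ht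
  have h₂ := (summable_sq_mul_exp_neg_pi_mul_int_sq ht).mul_left (π * (t - u))
  rw [← tsum_mul_left, ← h₀.tsum_add h₂]
  refine (h₀.add h₂).tsum_le_tsum (fun n => ?_) (summable_exp_neg_pi_mul_int_sq hu)
  have hexp : Real.exp (-π * u * (n : ℝ) ^ 2) =
      Real.exp (π * (t - u) * (n : ℝ) ^ 2) * Real.exp (-π * t * (n : ℝ) ^ 2) := by
    rw [← Real.exp_add]
    ring_nf
  rw [hexp]
  nlinarith [mul_le_mul_of_nonneg_right (Real.add_one_le_exp (π * (t - u) * (n : ℝ) ^ 2))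
    (Real.exp_pos (-π * t * (n : ℝ) ^ 2)).le]

theorem pi_mul_tsum_sq_mul_exp_neg_pi_mul_int_sq_le {s : ℝ} (hs : 0 < s) :
    π * (s * (s + s)) * ∑' n : ℤ, (n : ℝ) ^ 2 * Real.exp (-π * s ^ 2 * (n : ℝ) ^ 2) ≤
      ∑' n : ℤ, Real.exp (-π * s ^ 2 * (n : ℝ) ^ 2) := by
  set M := ∑' n : ℤ, (n : ℝ) ^ 2 * Real.exp (-π * s ^ 2 * (n : ℝ) ^ 2)
  set S := ∑' n : ℤ, Real.exp (-π * s ^ 2 * (n : ℝ) ^ 2)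
  have hlim : Filter.Tendsto (fun r : ℝ => π * (r * (s + r)) * M) (nhdsWithin s (Set.Iio s))
      (nhds (π * (s * (s + s)) * M)) :=
    (Continuous.tendsto (by fun_prop) s).mono_left nhdsWithin_le_nhds
  refine le_of_tendsto hlim ?_
  filter_upwards [Ioo_mem_nhdsLT hs] with r ⟨hr, hrs⟩
  have hconv := mul_le_mul_of_nonneg_left
    (tsum_exp_neg_pi_mul_int_sq_add_le (pow_pos hs 2) (pow_pos hr 2)) hr.le
  have hmono := hconv.trans (mul_tsum_exp_neg_pi_mul_int_sq_le hr hrs.le)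
  refine le_of_mul_le_mul_left ?_ (sub_pos.2 hrs)
  linear_combination hmono

/-- **Variance bound for the discrete Gaussian weights.**
For every `σ > 0`, `∑_{x ∈ ℤ} x² exp(-x²/(2σ²)) ≤ σ² · ∑_{x ∈ ℤ} exp(-x²/(2σ²))`;
equivalently a discrete Gaussian `Z ∼ 𝒩_ℤ(0,σ²)` satisfies
`Var[Z] ≤ E[Z²] ≤ σ²`. -/
theorem discrete_gaussian_variance_bound
    (σ : ℝ) (hσ : 0 < σ) :
    (∑' x : ℤ, ((x : ℝ) ^ 2) * Real.exp (-(x : ℝ) ^ 2 / (2 * σ ^ 2)))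
      ≤ σ ^ 2 * ∑' x : ℤ, Real.exp (-(x : ℝ) ^ 2 / (2 * σ ^ 2)) := by
  set s : ℝ := (σ * √(2 * π))⁻¹ with hs_def
  have hs : 0 < s := by positivity
  have hs2 : s ^ 2 = 1 / (2 * π * σ ^ 2) := by
    rw [hs_def, inv_pow, mul_pow, Real.sq_sqrt (by positivity), one_div, mul_comm]
  have hexp (x : ℤ) : -(x : ℝ) ^ 2 / (2 * σ ^ 2) = -π * s ^ 2 * (x : ℝ) ^ 2 := by
    rw [hs2]
    field_simp
  have hcoef : π * (s * (s + s)) = (σ ^ 2)⁻¹ := by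
    rw [show π * (s * (s + s)) = 2 * π * s ^ 2 by ring, hs2]
    field_simp
  have h := pi_mul_tsum_sq_mul_exp_neg_pi_mul_int_sq_le hs
  rw [hcoef, inv_mul_le_iff₀ (by positivity)] at h
  simpa only [hexp] using h
end

section
/- Per-branch error propagation bound: let $m \ge 1$, let $q \in \mathbb{N}_0^m$ be a vector of nonnegative integers, let $\tilde{q} \in \mathbb{Z}^m$, let $c \in \mathbb{N}_0$, and let $F = \{x \in \mathbb{Z}^m : x_j \ge 0 \text{ for all } j,\ \sum_j x_j = c\}$. Suppose $\bar{q} \in F$ minimizes $\|\tilde{q} - x\|_\infty$ over $x \in F$. Then for every coordinate $j \in \{1,\dots,m\}$, $|q_j - \bar{q}_j| \le 2\, \|\tilde{q} - q\|_\infty + \big|\, c - \sum_{i=1}^m q_i \,\big|$. -/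
/-- The Chebyshev (maximum) norm `‖v‖_∞ = max_j |v_j|` of an integer vector,
as a natural number. -/
def chebNorm {m : ℕ} (v : Fin m → ℤ) : ℕ :=
  Finset.univ.sup fun j => (v j).natAbs

theorem natAbs_le_chebNorm {m : ℕ} (v : Fin m → ℤ) (j : Fin m) : (v j).natAbs ≤ chebNorm v :=
  Finset.le_sup (f := fun j => (v j).natAbs) (Finset.mem_univ j)

theorem chebNorm_le {m : ℕ} {v : Fin m → ℤ} {b : ℕ} (h : ∀ j, (v j).natAbs ≤ b) :
    chebNorm v ≤ b :=
  Finset.sup_le fun j _ => h j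

/-- Every natural number below the total of `q` is the total of some `x ≤ q`. -/
theorem exists_le_sum_eq {ι : Type*} [Fintype ι] (q : ι → ℕ) {k : ℕ} (hk : k ≤ ∑ i, q i) :
    ∃ x ≤ q, ∑ i, x i = k := by
  classical
  induction k with
  | zero => exact ⟨0, fun _ => Nat.zero_le _, by simp⟩
  | succ k ih =>
    obtain ⟨x, hx, hsum⟩ := ih (by omega)
    obtain ⟨j, -, hj⟩ := Finset.exists_lt_of_sum_lt (show ∑ i, x i < ∑ i, q i by omega)
    refine ⟨x + Pi.single j 1, fun i => ?_, by simp [Finset.sum_add_distrib, hsum]⟩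
    rcases eq_or_ne i j with rfl | hij
    · simpa using hj
    · simpa [hij] using hx i

/-- A vector of natural numbers can be moved to any prescribed total by changing each coordinate
by at most the discrepancy between the totals. -/
theorem exists_sum_eq_abs_sub_le {ι : Type*} [Fintype ι] [Nonempty ι] (q : ι → ℕ) (c : ℕ) :
    ∃ x : ι → ℕ, ∑ i, x i = c ∧
      ∀ j, |(q j : ℤ) - x j| ≤ |(c : ℤ) - ∑ i, (q i : ℤ)| := by
  classical
  rcases le_total c (∑ i, q i) with hc | hc
  · obtain ⟨x, hx, hsum⟩ := exists_le_sum_eq q hc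
    refine ⟨x, hsum, fun j => ?_⟩
    have hle : ∀ i, (0 : ℤ) ≤ q i - x i := fun i => sub_nonneg.2 (Nat.cast_le.2 (hx i))
    have hj : (q j : ℤ) - x j ≤ ∑ i, ((q i : ℤ) - x i) :=
      Finset.single_le_sum (f := fun i => (q i : ℤ) - x i) (fun i _ => hle i) (Finset.mem_univ j)
    rw [abs_of_nonneg (hle j), abs_sub_comm, ← hsum, Nat.cast_sum, ← Finset.sum_sub_distrib]
    exact hj.trans (le_abs_self _)
  · obtain ⟨j₀⟩ := ‹Nonempty ι›
    refine ⟨q + Pi.single j₀ (c - ∑ i, q i), ?_, fun j => ?_⟩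
    · simp [Finset.sum_add_distrib, hc]
    · rw [← Nat.cast_sum]
      rcases eq_or_ne j j₀ with rfl | hj
      · simp [Nat.cast_sub hc, abs_sub_comm]
      · simp [hj]

/-- **Per-branch error propagation bound.**
Let `q ∈ ℕ₀^m` be the true children counts, `q̃ ∈ ℤ^m` their noisy version,
`c ∈ ℕ₀` the privatized parent count, and let `q̄` minimize `‖q̃ - x‖_∞` over
the feasible region `F = {x ∈ ℤ^m : x_j ≥ 0 ∀ j, ∑_j x_j = c}`.  Then each
coordinate satisfies `|q_j - q̄_j| ≤ 2‖q̃ - q‖_∞ + |c - ∑_i q_i|`. -/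
theorem per_branch_error_propagation
    (m : ℕ) (hm : 1 ≤ m) (q : Fin m → ℕ) (tq : Fin m → ℤ) (c : ℕ)
    (F : Set (Fin m → ℤ))
    (hF : F = {x : Fin m → ℤ | (∀ j, 0 ≤ x j) ∧ ∑ j, x j = (c : ℤ)})
    (qbar : Fin m → ℤ) (hqbar : qbar ∈ F)
    (hmin : ∀ x ∈ F, chebNorm (fun j => tq j - qbar j) ≤ chebNorm (fun j => tq j - x j)) :
    ∀ j : Fin m,
      |(q j : ℤ) - qbar j|
        ≤ 2 * (chebNorm (fun i => tq i - (q i : ℤ)) : ℤ)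
          + |(c : ℤ) - ∑ i, (q i : ℤ)| := by
  subst hF
  intro j
  have : Nonempty (Fin m) := ⟨j⟩
  obtain ⟨x, hsum, hx⟩ := exists_sum_eq_abs_sub_le q c
  simp only [Int.abs_eq_natAbs] at hx ⊢
  have hopt := hmin (fun i => (x i : ℤ)) ⟨fun i => by positivity, by simp [← hsum]⟩
  have hbar := natAbs_le_chebNorm (fun i => tq i - qbar i) j
  have hq := natAbs_le_chebNorm (fun i => tq i - (q i : ℤ))
  have hfeas : chebNorm (fun i => tq i - (x i : ℤ)) ≤
      chebNorm (fun i => tq i - (q i : ℤ)) + ((c : ℤ) - ∑ i, (q i : ℤ)).natAbs :=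
    chebNorm_le fun i => by have := hq i; have := hx i; omega
  have := hq j
  omega
end

section
/- Deterministic utility bound for the TopDown mechanism (core of the utility theorem for InfTDA): let $\mathcal{X}_1,\dots,\mathcal{X}_d$ be finite nonempty sets, and for $0 \le k \le d$ write $P_k = \mathcal{X}_1\times\dots\times\mathcal{X}_k$ (with $P_0$ a one-point set). Suppose given: (a) true counts $q_k : P_k \to \mathbb{N}_0$ for $0 \le k \le d$ that are hierarchically consistent, i.e., $q_k(u) = \sum_{y \in \mathcal{X}_{k+1}} q_{k+1}(u, y)$ for all $0 \le k \le d-1$ and $u \in P_k$; (b) noisy values $\tilde{q}_k : P_k \to \mathbb{Z}$ for $1 \le k \le d$; (c) privatized counts $\bar{q}_k : P_k \to \mathbb{N}_0$ for $0 \le k \le d$ such that $\bar{q}_0 = q_0$ and, for every $1 \le k \le d$ and every $u \in P_{k-1}$, the vector $(\bar{q}_k(u, y))_{y \in \mathcal{X}_k}$ satisfies the consistency constraint $\sum_{y \in \mathcal{X}_k} \bar{q}_k(u, y) = \bar{q}_{k-1}(u)$ and minimizes $\max_{y \in \mathcal{X}_k} |\tilde{q}_k(u, y) - x_y|$ over all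 vectors $x \in \mathbb{N}_0^{\mathcal{X}_k}$ with $\sum_{y} x_y = \bar{q}_{k-1}(u)$. Then for every $0 \le k \le d$: $\max_{u \in P_k} |q_k(u) - \bar{q}_k(u)| \le 2 \sum_{\ell=1}^{k} \max_{v \in P_{\ell-1}} \max_{y \in \mathcal{X}_\ell} |\tilde{q}_\ell(v, y) - q_\ell(v, y)|$. -/
/-- Below a natural-valued function there is one of any prescribed smaller total. -/
theorem Finset.exists_le_sum_eq {ι : Type*} (s : Finset ι) (f : ι → ℕ) (m : ℕ)
    (hm : m ≤ ∑ i ∈ s, f i) : ∃ g : ι → ℕ, g ≤ f ∧ ∑ i ∈ s, g i = m := by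
  classical
  induction s using Finset.induction_on generalizing m with
  | empty => exact ⟨f, le_rfl, by simpa [eq_comm] using hm⟩
  | insert a s ha ih =>
    rw [Finset.sum_insert ha] at hm
    obtain ⟨g, hgf, hg⟩ := ih (m - min m (f a)) (by omega)
    refine ⟨Function.update g a (min m (f a)), fun i => ?_, ?_⟩
    · obtain rfl | hi := eq_or_ne i a
      · simp
      · simpa [hi] using hgf i
    · rw [Finset.sum_insert ha, Function.update_self, Finset.sum_update_of_notMem ha, hg]
      omega

/-- The total of a natural-valued function can be changed to any value by moving each entry
by at most the change of the total. -/
theorem exists_sum_eq_natAbs_sub_le {ι : Type*} [Fintype ι] [Nonempty ι] (f : ι → ℕ) (m : ℕ) :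
    ∃ g : ι → ℕ, ∑ i, g i = m ∧
      ∀ i, ((f i : ℤ) - g i).natAbs ≤ (((∑ j, f j : ℕ) : ℤ) - m).natAbs := by
  classical
  obtain hm | hm := le_total m (∑ j, f j)
  · obtain ⟨g, hgf, hg⟩ := Finset.univ.exists_le_sum_eq f m hm
    refine ⟨g, hg, fun i => ?_⟩
    have hsub : f i - g i ≤ ∑ j, (f j - g j) :=
      Finset.single_le_sum (f := fun j => f j - g j) (fun _ _ => Nat.zero_le _)
        (Finset.mem_univ i)
    have hadd : ∑ j, (f j - g j) + ∑ j, g j = ∑ j, f j := by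
      rw [← Finset.sum_add_distrib]
      exact Finset.sum_congr rfl fun j _ => Nat.sub_add_cancel (hgf j)
    have hi : g i ≤ f i := hgf i
    omega
  · obtain ⟨a⟩ := ‹Nonempty ι›
    refine ⟨fun i => f i + if i = a then m - ∑ j, f j else 0, ?_, fun i => ?_⟩
    · rw [Finset.sum_add_distrib, Finset.sum_ite_eq' Finset.univ a, if_pos (Finset.mem_univ a)]
      omega
    · dsimp only
      split_ifs <;> omega

/-- A Chebyshev projection `b` of `t` onto the natural vectors of a given total deviates from
any `f` by at most twice the distance of `f` to `t` plus the discrepancy of the totals. -/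
theorem natAbs_sub_le_of_chebyshev_optimal {ι : Type*} [Fintype ι] [Nonempty ι]
    (f b : ι → ℕ) (t : ι → ℤ) (E : ℕ) (hE : ∀ i, (t i - f i).natAbs ≤ E)
    (hopt : ∀ x : ι → ℕ, ∑ i, x i = ∑ i, b i →
      (Finset.univ.sup fun i => (t i - (b i : ℤ)).natAbs)
        ≤ Finset.univ.sup fun i => (t i - (x i : ℤ)).natAbs) (i : ι) :
    ((f i : ℤ) - b i).natAbs
      ≤ (((∑ j, f j : ℕ) : ℤ) - ((∑ j, b j : ℕ) : ℤ)).natAbs + 2 * E := by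
  obtain ⟨x, hx, hfx⟩ := exists_sum_eq_natAbs_sub_le f (∑ j, b j)
  have hbound : (Finset.univ.sup fun j => (t j - (x j : ℤ)).natAbs)
      ≤ E + (((∑ j, f j : ℕ) : ℤ) - ((∑ j, b j : ℕ) : ℤ)).natAbs := by
    refine Finset.sup_le fun j _ => ?_
    have := hE j
    have := hfx j
    omega
  have hb := (Finset.le_sup (f := fun j => (t j - (b j : ℤ)).natAbs)
    (Finset.mem_univ i)).trans ((hopt x hx).trans hbound)
  have := hE i
  omega

/-- **Deterministic utility bound for the TopDown mechanism (core of the utility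
theorem for `InfTDA`).**

Nodes at level `k` of the hierarchical tree (i.e. elements of
`P_k = X_1 × ⋯ × X_k`) are encoded as full tuples `u : ∀ i, X i` together with
the hypothesis that the level-`k` functions depend only on the first `k`
coordinates; the child `(u, y)` of a level-`k` node `u` is `Function.update u k y`.

Given hierarchically consistent true counts `q`, noisy values `tq`, and
privatized counts `qbar` with `qbar 0 = q 0`, where at each level the children
vector of `qbar` sums to the parent's `qbar`-count and minimizes the Chebyshev
distance to the noisy children vector among all nonnegative integer vectors with
that sum, the maximum absolute error at level `k` is at most
`2 ∑_{ℓ=1}^{k} max_{v ∈ P_{ℓ-1}} max_{y ∈ X_ℓ} |tq_ℓ(v,y) - q_ℓ(v,y)|`. -/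
theorem topdown_deterministic_utility
    {d : ℕ} (X : Fin d → Type) [∀ i, Fintype (X i)] [∀ i, Nonempty (X i)]
    (q : ℕ → (∀ i, X i) → ℕ)
    (tq : ℕ → (∀ i, X i) → ℤ)
    (qbar : ℕ → (∀ i, X i) → ℕ)
    -- the level-`k` functions depend only on the first `k` coordinates
    (hq_pref : ∀ k, k ≤ d → ∀ u v : ∀ i, X i,
      (∀ i : Fin d, i.val < k → u i = v i) → q k u = q k v)
    (htq_pref : ∀ k, k ≤ d → ∀ u v : ∀ i, X i,
      (∀ i : Fin d, i.val < k → u i = v i) → tq k u = tq k v)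
    (hqbar_pref : ∀ k, k ≤ d → ∀ u v : ∀ i, X i,
      (∀ i : Fin d, i.val < k → u i = v i) → qbar k u = qbar k v)
    -- (a) hierarchical consistency of the true counts
    (hcons : ∀ (k : ℕ) (hk : k < d), ∀ u : ∀ i, X i,
      q k u = ∑ z : X ⟨k, hk⟩, q (k + 1) (Function.update u ⟨k, hk⟩ z))
    -- (c) root condition
    (hroot : ∀ u : ∀ i, X i, qbar 0 u = q 0 u)
    -- (c) level-wise consistency constraint and Chebyshev optimality
    (hopt : ∀ (k : ℕ) (hk : k < d), ∀ u : ∀ i, X i,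
      (∑ z : X ⟨k, hk⟩, qbar (k + 1) (Function.update u ⟨k, hk⟩ z) = qbar k u) ∧
      ∀ x : X ⟨k, hk⟩ → ℕ, (∑ z, x z = qbar k u) →
        (Finset.univ.sup fun z : X ⟨k, hk⟩ =>
            (tq (k + 1) (Function.update u ⟨k, hk⟩ z)
              - (qbar (k + 1) (Function.update u ⟨k, hk⟩ z) : ℤ)).natAbs)
          ≤ Finset.univ.sup fun z : X ⟨k, hk⟩ =>
              (tq (k + 1) (Function.update u ⟨k, hk⟩ z) - (x z : ℤ)).natAbs) :
    ∀ k, k ≤ d →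
      (Finset.univ.sup fun u : ∀ i, X i => ((q k u : ℤ) - (qbar k u : ℤ)).natAbs)
        ≤ 2 * ∑ ℓ ∈ Finset.range k,
            Finset.univ.sup fun v : ∀ i, X i =>
              (tq (ℓ + 1) v - (q (ℓ + 1) v : ℤ)).natAbs := by
  intro k
  induction k with
  | zero => simp [hroot]
  | succ k ih =>
    intro hk
    have hkd : k < d := hk
    refine Finset.sup_le fun u _ => ?_
    obtain ⟨hsum, hmin⟩ := hopt k hkd u
    have hstep := natAbs_sub_le_of_chebyshev_optimal
      (fun z => q (k + 1) (Function.update u ⟨k, hkd⟩ z))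
      (fun z => qbar (k + 1) (Function.update u ⟨k, hkd⟩ z))
      (fun z => tq (k + 1) (Function.update u ⟨k, hkd⟩ z)) _
      (fun z => Finset.le_sup (f := fun v => (tq (k + 1) v - (q (k + 1) v : ℤ)).natAbs)
        (Finset.mem_univ _))
      (fun x hx => hmin x (hx.trans hsum)) (u ⟨k, hkd⟩)
    rw [← hcons k hkd u, hsum] at hstep
    simp only [Function.update_eq_self] at hstep
    have hparent := (Finset.le_sup
      (f := fun v : ∀ i, X i => ((q k v : ℤ) - (qbar k v : ℤ)).natAbs)
      (Finset.mem_univ u)).trans (ih hkd.le)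
    rw [Finset.sum_range_succ, mul_add]
    exact hstep.trans (Nat.add_le_add_right hparent _)
end
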